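/- If K is an origin-symmetric convex body in R^n whose John ellipsoid (maximal-volume inscribed ellipsoid) is the unit ball B^n_2, then ℓ(K) ≥ ℓ(B^n_∞), where ℓ is the Gaussian ℓ-norm and B^n_∞ = [-1,1]^n. Equality holds if and only if K is a cube circumscribed about B^n_2. -/

import Mathlib

open MeasureTheory
open scoped RealInnerProductSpace

/-- The standard Gaussian measure on `ℝ^n`. -/
noncomputable def gaussianMeasure (n : ℕ) : Measure (EuclideanSpace ℝ (Fin n)) :=
  volume.withDensity
    (fun x => ENNReal.ofReal ((2 * Real.pi) ^ (-(n : ℝ) / 2) * Real.exp (-‖x‖ ^ 2 / 2)))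

/-- The Gaussian ℓ-norm: `ℓ(K) = ∫ ‖x‖_K dγ_n(x)` with `‖·‖_K` the gauge of `K`. -/
noncomputable def ellNorm {n : ℕ} (K : Set (EuclideanSpace ℝ (Fin n))) : ℝ :=
  ∫ x, gauge K x ∂(gaussianMeasure n)

/-- The cube `B^n_∞ = [-1,1]^n`. -/
def unitCube (n : ℕ) : Set (EuclideanSpace ℝ (Fin n)) :=
  {x | ∀ i, |x i| ≤ 1}

theorem jb_isCompact_convexHull {F : Type} [NormedAddCommGroup F] [NormedSpace ℝ F]
    [FiniteDimensional ℝ F] {s : Set F} (hs : IsCompact s) : IsCompact (convexHull ℝ s) := by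
  let f : (k : ℕ) → (Fin k → ℝ) × (Fin k → F) → F := fun k p => ∑ i, p.1 i • p.2 i
  have key : convexHull ℝ s = ⋃ k ∈ (Finset.range (Module.finrank ℝ F + 2)),
      f k '' (stdSimplex ℝ (Fin k) ×ˢ Set.univ.pi (fun _ => s)) := by
    ext x
    constructor
    · intro hx
      obtain ⟨ι, _, z, w, hz, haff, hw, hw1, hx⟩ := eq_pos_convex_span_of_mem_convexHull hx
      have hcard := haff.card_le_finrank_succ
      have h2 : Fintype.card ι < Module.finrank ℝ F + 2 := by
        have := Submodule.finrank_le (vectorSpan ℝ (Set.range z))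
        omega
      let e := Fintype.equivFin ι
      simp only [Set.mem_iUnion]
      refine ⟨Fintype.card ι, Finset.mem_range.2 h2, ⟨w ∘ e.symm, z ∘ e.symm⟩, ⟨⟨fun i => (hw _).le, ?_⟩, ?_⟩, ?_⟩
      · rw [← hw1]; exact e.symm.sum_comp w
      · intro i _; exact hz ⟨_, rfl⟩
      · rw [← hx]; exact e.symm.sum_comp (fun i => w i • z i)
    · simp only [Set.mem_iUnion]
      rintro ⟨k, _, ⟨w, z⟩, ⟨hw, hz⟩, rfl⟩
      exact (convex_convexHull ℝ s).sum_mem (fun i _ => hw.1 i) hw.2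
        (fun i _ => subset_convexHull ℝ s (hz i trivial))
  rw [key]
  refine (Finset.range _).isCompact_biUnion fun k _ => ?_
  refine ((isCompact_stdSimplex ℝ (Fin k)).prod (isCompact_univ_pi fun _ => hs)).image ?_
  fun_prop

/-- unit vectors in the polar body -/
def jbContact {n : ℕ} (K : Set (EuclideanSpace ℝ (Fin n))) : Set (EuclideanSpace ℝ (Fin n)) :=
  {u | ‖u‖ = 1 ∧ ∀ x ∈ K, |⟪x, u⟫| ≤ 1}

theorem jb_isCompact_polar {n : ℕ} {K : Set (EuclideanSpace ℝ (Fin n))}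
    (hK1 : Metric.closedBall 0 1 ⊆ K) :
    IsCompact {u : EuclideanSpace ℝ (Fin n) | ∀ x ∈ K, |⟪x, u⟫| ≤ 1} ∧
      ∀ u ∈ {u : EuclideanSpace ℝ (Fin n) | ∀ x ∈ K, |⟪x, u⟫| ≤ 1}, ‖u‖ ≤ 1 := by
  have hb : ∀ u ∈ {u : EuclideanSpace ℝ (Fin n) | ∀ x ∈ K, |⟪x, u⟫| ≤ 1}, ‖u‖ ≤ 1 := by
    intro u hu
    by_cases h0 : u = 0
    · simp [h0]
    have hp : 0 < ‖u‖ := norm_pos_iff.2 h0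
    have := hu (‖u‖⁻¹ • u) (hK1 (by simp [norm_smul, hp.ne']))
    rw [real_inner_smul_left, real_inner_self_eq_norm_sq] at this
    have h3 : ‖u‖⁻¹ * ‖u‖^2 = ‖u‖ := by field_simp
    rw [h3] at this
    exact (le_abs_self _).trans this
  refine ⟨?_, hb⟩
  refine Metric.isCompact_of_isClosed_isBounded ?_ ?_
  · have : {u : EuclideanSpace ℝ (Fin n) | ∀ x ∈ K, |⟪x, u⟫| ≤ 1} =
        ⋂ x ∈ K, {u | |⟪x, u⟫| ≤ 1} := by ext; simp
    rw [this]
    refine isClosed_biInter fun x _ => isClosed_le (by fun_prop) continuous_const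
  · refine (Metric.isBounded_closedBall (x := (0 : EuclideanSpace ℝ (Fin n))) (r := 1)).subset ?_
    intro u hu
    simpa using hb u hu

theorem jb_isCompact_contact {n : ℕ} {K : Set (EuclideanSpace ℝ (Fin n))}
    (hK1 : Metric.closedBall 0 1 ⊆ K) : IsCompact (jbContact K) := by
  have := (jb_isCompact_polar hK1).1.inter_left (isClosed_eq (f := fun u : EuclideanSpace ℝ (Fin n) => ‖u‖) (g := fun _ => (1:ℝ)) (by fun_prop) (by fun_prop))
  exact this

theorem jb_trace_le {n : ℕ} {K : Set (EuclideanSpace ℝ (Fin n))}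
    (hKconv : Convex ℝ K) (hKcomp : IsCompact K) (hKsymm : ∀ x ∈ K, -x ∈ K)
    (hK1 : Metric.closedBall 0 1 ⊆ K)
    (hJohn : ∀ T : EuclideanSpace ℝ (Fin n) ≃L[ℝ] EuclideanSpace ℝ (Fin n),
      T '' Metric.closedBall 0 1 ⊆ K →
        volume (T '' Metric.closedBall 0 1) ≤
          volume (Metric.closedBall (0 : EuclideanSpace ℝ (Fin n)) 1))
    (H : Matrix (Fin n) (Fin n) ℝ)
    (hH : ∀ u ∈ jbContact K, ⟪Matrix.toEuclideanCLM (𝕜 := ℝ) H u, u⟫ < 0) : H.trace ≤ 0 := by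
  by_contra! htr
  set B := Matrix.toEuclideanCLM (𝕜 := ℝ) H with hB
  set A := ContinuousLinearMap.adjoint B with hA
  obtain ⟨hpc, hpb⟩ := jb_isCompact_polar hK1
  have e1 : ∀ᶠ ε in nhds (0:ℝ), ∀ v ∈ {u : EuclideanSpace ℝ (Fin n) | ∀ x ∈ K, |⟪x, u⟫| ≤ 1},
      0 < ε → ‖v‖ ≤ 1 → ‖v + ε • A v‖ ≤ 1 := by
    refine hpc.eventually_forall_of_forall_eventually (P := fun ε v => 0 < ε → ‖v‖ ≤ 1 → ‖v + ε • A v‖ ≤ 1) ?_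
    intro v hv
    rcases (hpb v hv).lt_or_eq with h | h
    · have : ContinuousAt (fun z : ℝ × EuclideanSpace ℝ (Fin n) => ‖z.2 + z.1 • A z.2‖) (0, v) := by
        fun_prop
      have := this.eventually_lt_const (u := 1) (by simpa using h)
      filter_upwards [this] with z hz _ _ using hz.le
    · have : ContinuousAt (fun z : ℝ × EuclideanSpace ℝ (Fin n) => 2 * ⟪B z.2, z.2⟫ + z.1 * ‖A z.2‖^2) (0, v) := by
        fun_prop
      have hneg := hH v ⟨h, hv⟩
      have := this.eventually_lt_const (u := 0) (by simp only [zero_mul, add_zero]; linarith)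
      filter_upwards [this] with z hz h1 h2
      have : ‖z.2 + z.1 • A z.2‖^2 ≤ 1 := by
        rw [norm_add_sq_real, real_inner_smul_right, norm_smul, mul_pow, Real.norm_eq_abs, sq_abs,
          hA, ContinuousLinearMap.adjoint_inner_right]
        have h4 : ‖z.2‖^2 ≤ 1 := by nlinarith [norm_nonneg z.2]
        have h5 : z.1 * (2 * ⟪B z.2, z.2⟫ + z.1 * ‖A z.2‖^2) ≤ 0 :=
          mul_nonpos_of_nonneg_of_nonpos h1.le hz.le
        linarith
      nlinarith [norm_nonneg (z.2 + z.1 • A z.2)]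
  have e2 : ∀ᶠ ε in nhds (0:ℝ), 0 < ε → 1 < (1 + ε • H).det := by
    have hc : ContinuousAt (fun ε : ℝ => H.trace + ε * Polynomial.eval ε (Matrix.det (1 + (Polynomial.X : Polynomial ℝ) • H.map Polynomial.C)).divX.divX) 0 := by
      fun_prop
    have := hc.eventually_const_lt (u := 0) (by simpa using htr)
    filter_upwards [this] with ε h1 h2
    rw [Matrix.det_one_add_smul]
    nlinarith [mul_pos h1 h2]
  obtain ⟨ε, ⟨h1, h2⟩, hε⟩ := (((e1.and e2).filter_mono (nhdsWithin_le_nhds (s := Set.Ioi 0))).and self_mem_nhdsWithin).exists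
  replace hε : 0 < ε := hε
  have hdet := h2 hε
  have hTdet : LinearMap.det ((1 + ε • B : EuclideanSpace ℝ (Fin n) →L[ℝ] EuclideanSpace ℝ (Fin n)) : EuclideanSpace ℝ (Fin n) →ₗ[ℝ] EuclideanSpace ℝ (Fin n)) = (1 + ε • H).det := by
    have : (1 + ε • B : EuclideanSpace ℝ (Fin n) →L[ℝ] EuclideanSpace ℝ (Fin n)) = Matrix.toEuclideanCLM (𝕜 := ℝ) (1 + ε • H) := by
      rw [map_add, map_one, map_smul]
    rw [this, Matrix.coe_toEuclideanCLM_eq_toEuclideanLin, Matrix.toEuclideanLin_eq_toLin, LinearMap.det_toLin]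
  set L := (1 + ε • B : EuclideanSpace ℝ (Fin n) →L[ℝ] EuclideanSpace ℝ (Fin n)) with hL
  have hne : LinearMap.det (L : EuclideanSpace ℝ (Fin n) →ₗ[ℝ] EuclideanSpace ℝ (Fin n)) ≠ 0 := by
    rw [hTdet]; linarith
  let T := ContinuousLinearMap.toContinuousLinearEquivOfDetNeZero L hne
  have hTL : ∀ x, T x = L x := fun x => rfl
  have hsub : T '' Metric.closedBall 0 1 ⊆ K := by
    rintro _ ⟨b, hb, rfl⟩
    by_contra hn
    obtain ⟨f, s, hf1, hf2⟩ := geometric_hahn_banach_closed_point hKconv hKcomp.isClosed hn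
    have hs : 0 < s := by
      have := hf1 0 (hK1 (by simp))
      simpa using this
    obtain ⟨v, hv⟩ : ∃ v : EuclideanSpace ℝ (Fin n), ∀ x, ⟪x, v⟫ = s⁻¹ * f x := by
      refine ⟨s⁻¹ • (InnerProductSpace.toDual ℝ (EuclideanSpace ℝ (Fin n))).symm f, fun x => ?_⟩
      rw [real_inner_smul_right, real_inner_comm, InnerProductSpace.toDual_symm_apply]
    have hvp : v ∈ {u : EuclideanSpace ℝ (Fin n) | ∀ x ∈ K, |⟪x, u⟫| ≤ 1} := by
      intro x hx
      have a1 := hf1 x hx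
      have a2 := hf1 _ (hKsymm x hx)
      rw [map_neg] at a2
      rw [hv, abs_mul, abs_of_pos (inv_pos.2 hs), inv_mul_le_one₀ hs]
      exact abs_le.2 ⟨by linarith, a1.le⟩
    have a3 := h1 v hvp hε (hpb v hvp)
    have a4 : ⟪T b, v⟫ = ⟪b, v + ε • A v⟫ := by
      rw [hTL, hL, inner_add_right, real_inner_smul_right, hA, ContinuousLinearMap.adjoint_inner_right]
      simp [inner_add_left, real_inner_smul_left]
    have a5 : ⟪T b, v⟫ ≤ 1 := by
      rw [a4]
      refine (real_inner_le_norm _ _).trans ?_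
      have : ‖b‖ ≤ 1 := by simpa using hb
      nlinarith [norm_nonneg b, norm_nonneg (v + ε • A v)]
    rw [hv, inv_mul_le_one₀ hs] at a5
    linarith
  have hvol := hJohn T hsub
  have : T '' Metric.closedBall 0 1 = L '' Metric.closedBall 0 1 := rfl
  rw [this, Measure.addHaar_image_continuousLinearMap] at hvol
  have hpos : 0 < volume (Metric.closedBall (0 : EuclideanSpace ℝ (Fin n)) 1) :=
    Metric.measure_closedBall_pos _ _ one_pos
  have hfin : volume (Metric.closedBall (0 : EuclideanSpace ℝ (Fin n)) 1) ≠ ⊤ :=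
    measure_closedBall_lt_top.ne
  have hd1 : 1 < ENNReal.ofReal |L.det| := by
    rw [ENNReal.one_lt_ofReal, ContinuousLinearMap.det, hTdet]
    exact lt_of_lt_of_le hdet (le_abs_self _)
  have := ENNReal.mul_lt_mul_left hpos.ne' hfin hd1
  rw [one_mul] at this
  exact absurd hvol (not_le.2 this)

theorem jb_john {n : ℕ} {K : Set (EuclideanSpace ℝ (Fin n))}
    (hKconv : Convex ℝ K) (hKcomp : IsCompact K) (hKsymm : ∀ x ∈ K, -x ∈ K)
    (hK1 : Metric.closedBall 0 1 ⊆ K)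
    (hJohn : ∀ T : EuclideanSpace ℝ (Fin n) ≃L[ℝ] EuclideanSpace ℝ (Fin n),
      T '' Metric.closedBall 0 1 ⊆ K →
        volume (T '' Metric.closedBall 0 1) ≤
          volume (Metric.closedBall (0 : EuclideanSpace ℝ (Fin n)) 1)) :
    ∃ (ι : Type) (_ : Fintype ι) (c : ι → ℝ) (u : ι → EuclideanSpace ℝ (Fin n)),
      (∀ i, 0 < c i) ∧ (∀ i, ‖u i‖ = 1) ∧ (∀ i, ∀ x ∈ K, |⟪x, u i⟫| ≤ 1) ∧
      ∀ x, ∑ i, (c i * ⟪u i, x⟫) • u i = x := by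
  rcases Nat.eq_zero_or_pos n with hn | hn
  · subst hn
    exact ⟨Empty, inferInstance, fun _ => 1, fun _ => 0, by simp, by simp, by simp, fun x => Subsingleton.elim _ _⟩
  let outer : EuclideanSpace ℝ (Fin n) → (Fin n → Fin n → ℝ) := fun u i j => u i * u j
  have hcont : Continuous outer := by
    refine continuous_pi fun i => continuous_pi fun j => ?_
    fun_prop
  have hcomp := jb_isCompact_convexHull ((jb_isCompact_contact hK1).image hcont)
  let I : Fin n → Fin n → ℝ := fun i j => (n:ℝ)⁻¹ * (1 : Matrix (Fin n) (Fin n) ℝ) i j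
  have hmem : I ∈ convexHull ℝ (outer '' jbContact K) := by
    by_contra hnot
    obtain ⟨f, s, hf1, hf2⟩ := geometric_hahn_banach_closed_point (convex_convexHull ℝ _) hcomp.isClosed hnot
    let H0 : Matrix (Fin n) (Fin n) ℝ := fun i j => f (Pi.single i (Pi.single j 1))
    have hf : ∀ M : Fin n → Fin n → ℝ, f M = ∑ i, ∑ j, M i j * H0 i j := by
      intro M
      have : M = ∑ i, ∑ j, M i j • (Pi.single i (Pi.single j 1) : Fin n → Fin n → ℝ) := by
        ext a b
        simp [Finset.sum_apply, Pi.single_apply, ite_apply]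
      conv_lhs => rw [this]
      simp [map_sum, H0]
    have := jb_trace_le hKconv hKcomp hKsymm hK1 hJohn (H0 - s • 1) ?_
    · rw [Matrix.trace_sub, Matrix.trace_smul, Matrix.trace_one] at this
      have h3 : f I = (n:ℝ)⁻¹ * H0.trace := by
        rw [hf]
        simp [I, Matrix.one_apply, Matrix.trace, Finset.mul_sum]
      rw [h3] at hf2
      have hn' : (0:ℝ) < n := by exact_mod_cast hn
      rw [lt_inv_mul_iff₀ hn'] at hf2
      simp at this
      linarith
    · intro u hu
      have h1 := hf1 (outer u) (subset_convexHull ℝ _ ⟨u, hu, rfl⟩)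
      have h2 : ⟪Matrix.toEuclideanCLM (𝕜 := ℝ) H0 u, u⟫ = f (outer u) := by
        rw [hf, real_inner_comm, Matrix.inner_toEuclideanCLM]
        simp [dotProduct, Matrix.mulVec, Finset.mul_sum, outer]
        refine Finset.sum_congr rfl fun i _ => Finset.sum_congr rfl fun j _ => by ring
      rw [map_sub, map_smul, map_one, sub_apply, inner_sub_left, h2]
      simp [real_inner_smul_left, hu.1]
      linarith
  obtain ⟨ι, _, z, w, hz, -, hw, hw1, hx⟩ := eq_pos_convex_span_of_mem_convexHull hmem
  have : ∀ i, ∃ u ∈ jbContact K, outer u = z i := fun i => hz ⟨i, rfl⟩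
  choose u hu huz using this
  refine ⟨ι, inferInstance, fun i => n * w i, u, fun i => mul_pos (by exact_mod_cast hn) (hw i), fun i => (hu i).1, fun i => (hu i).2, ?_⟩
  intro x
  ext a
  have hn' : (0:ℝ) ≠ n := by exact_mod_cast hn.ne
  have key : ∀ b, ∑ i, w i * (u i a * u i b) = I a b := by
    intro b
    rw [← hx]
    simp [← huz, outer, Finset.sum_apply]
  have : (∑ i, ((n * w i) * ⟪u i, x⟫) • u i) a = ∑ b, n * (∑ i, w i * (u i a * u i b)) * x b := by
    simp only [WithLp.ofLp_sum, WithLp.ofLp_smul, Finset.sum_apply, Pi.smul_apply, smul_eq_mul, PiLp.inner_apply, Finset.mul_sum, Finset.sum_mul]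
    rw [Finset.sum_comm]
    refine Finset.sum_congr rfl fun i _ => Finset.sum_congr rfl fun j _ => ?_
    simp
    ring
  rw [this]
  simp only [key, I]
  simp [Matrix.one_apply, hn'.symm]

theorem jb_phi (t : ℝ) (ht : 0 < t) : ∃ φ φ' : ℝ → ℝ,
    (∀ s ∈ Set.Ioo (-t) t, HasDerivAt φ (φ' s) s ∧ 0 < φ' s ∧
      Real.exp (-s ^ 2 / 2) = ((∫ x in (-t)..t, Real.exp (-x ^ 2 / 2)) / √(2 * Real.pi)) *
        (Real.exp (-(φ s) ^ 2 / 2) * φ' s)) ∧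
    StrictMonoOn φ (Set.Ioo (-t) t) ∧ (∀ s ∈ Set.Ioo (-t) t, φ (-s) = - φ s) ∧
    (∀ M, ∃ s ∈ Set.Ioo 0 t, M ≤ φ s) := by
  let g : ℝ → ℝ := fun x => Real.exp (-x ^ 2 / 2)
  have gc : Continuous g := by fun_prop
  have gpos : ∀ x, 0 < g x := fun x => Real.exp_pos _
  have geven : ∀ x, g (-x) = g x := fun x => by simp [g]
  let F : ℝ → ℝ := fun s => ∫ x in (0:ℝ)..s, g x
  have hF : ∀ s, HasStrictDerivAt F (g s) s := fun s =>
    gc.integral_hasStrictDerivAt 0 s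
  have Fc : Continuous F := continuous_iff_continuousAt.2 fun s => (hF s).hasDerivAt.continuousAt
  have Fmono : StrictMono F := strictMono_of_deriv_pos fun s => by
    rw [(hF s).hasDerivAt.deriv]; exact gpos s
  have F0 : F 0 = 0 := by simp [F]
  have Fodd : ∀ s, F (-s) = - F s := by
    intro s
    have := intervalIntegral.integral_comp_neg (a := 0) (b := s) g
    simp only [geven, neg_zero] at this
    simp only [F]
    rw [this, intervalIntegral.integral_symm]
  have gint : Integrable g := by
    have := integrable_exp_neg_mul_sq (b := 1/2) (by norm_num)
    refine this.congr (Filter.Eventually.of_forall fun x => ?_)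
    simp only [g]; congr 1; ring
  have hlim : Filter.Tendsto F Filter.atTop (nhds (√(2 * Real.pi) / 2)) := by
    have h1 := intervalIntegral_tendsto_integral_Ioi 0 gint.integrableOn Filter.tendsto_id
    have h2 : ∫ x in Set.Ioi (0:ℝ), g x = √(2 * Real.pi) / 2 := by
      have := integral_gaussian_Ioi (1/2)
      rw [show √(2 * Real.pi) = √(Real.pi / (1/2)) by congr 1; ring, ← this]
      refine integral_congr_ae (Filter.Eventually.of_forall fun x => ?_)
      simp only [g]; congr 1; ring
    rw [h2] at h1
    exact h1
  set Z := √(2 * Real.pi) with hZ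
  have Zpos : 0 < Z := Real.sqrt_pos.2 (by positivity)
  have Flt : ∀ s, F s < Z / 2 := fun s =>
    lt_of_lt_of_le (Fmono (lt_add_one s)) (Fmono.monotone.ge_of_tendsto hlim _)
  have Fneg : ∀ s, -(Z / 2) < F s := fun s => by
    have := Flt (-s); rw [Fodd] at this; linarith
  have Fsurj : ∀ y ∈ Set.Ioo (-(Z/2)) (Z/2), ∃ s, F s = y := by
    have hp : ∀ y, 0 ≤ y → y < Z/2 → ∃ s, F s = y := by
      intro y h0 hy
      obtain ⟨b, hb⟩ := (hlim.eventually_const_lt hy).exists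
      have hb0 : 0 ≤ b := by
        by_contra! h
        have := Fmono h
        rw [F0] at this; linarith
      obtain ⟨s, -, hs⟩ := intermediate_value_Icc hb0 Fc.continuousOn ⟨by rw [F0]; exact h0, hb.le⟩
      exact ⟨s, hs⟩
    intro y hy
    rcases le_total 0 y with h | h
    · exact hp y h hy.2
    · obtain ⟨s, hs⟩ := hp (-y) (by linarith) (by linarith [hy.1])
      exact ⟨-s, by rw [Fodd, hs]; ring⟩
  have hI : ∫ x in (-t)..t, Real.exp (-x ^ 2 / 2) = 2 * F t := by
    have : (∫ x in (-t)..(0:ℝ), g x) + ∫ x in (0:ℝ)..t, g x = ∫ x in (-t)..t, g x :=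
      intervalIntegral.integral_add_adjacent_intervals (gc.intervalIntegrable _ _) (gc.intervalIntegrable _ _)
    have h2 : ∫ x in (-t)..(0:ℝ), g x = F t := by
      rw [intervalIntegral.integral_symm]
      have := Fodd t
      simp only [F] at this ⊢
      linarith
    change ∫ x in (-t)..t, g x = _
    rw [← this, h2]; simp only [F]; ring
  have Ftpos : 0 < F t := by rw [← F0]; exact Fmono ht
  set κ := Z / (2 * F t) with hκ
  have κpos : 0 < κ := by positivity
  have κF : κ * F t = Z / 2 := by rw [hκ]; field_simp
  have hoe : Topology.IsOpenEmbedding F :=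
    .of_continuous_injective_isOpenMap Fc Fmono.injective
      (isOpenMap_of_hasStrictDerivAt (f' := g) hF fun x => (gpos x).ne')
  let G : ℝ → ℝ := Function.invFun F
  have GF : ∀ s, G (F s) = s := Function.leftInverse_invFun Fmono.injective
  have FG : ∀ y ∈ Set.Ioo (-(Z/2)) (Z/2), F (G y) = y := fun y hy => Function.invFun_eq (Fsurj y hy)
  have Gc : ∀ s, ContinuousAt G (F s) := fun s => by
    rw [← hoe.continuousAt_iff (g := G)]
    have : G ∘ F = id := funext GF
    rw [this]; exact continuousAt_id
  have hmem : ∀ s ∈ Set.Ioo (-t) t, κ * F s ∈ Set.Ioo (-(Z/2)) (Z/2) := by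
    intro s hs
    rw [← κF]
    constructor
    · have := Fmono hs.1
      rw [Fodd] at this
      nlinarith
    · have := Fmono hs.2
      nlinarith
  have hFφ : ∀ s ∈ Set.Ioo (-t) t, F (G (κ * F s)) = κ * F s := fun s hs => FG _ (hmem s hs)
  refine ⟨fun s => G (κ * F s), fun s => (g (G (κ * F s)))⁻¹ * (κ * g s), ?_, ?_, ?_, ?_⟩
  · intro s hs
    refine ⟨?_, mul_pos (inv_pos.2 (gpos _)) (mul_pos κpos (gpos _)), ?_⟩
    · have h1 : HasDerivAt G (g (G (κ * F s)))⁻¹ (κ * F s) := by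
        refine HasDerivAt.of_local_left_inverse ?_ (hF _).hasDerivAt (gpos _).ne' ?_
        · rw [← hFφ s hs]; exact Gc _
        · filter_upwards [isOpen_Ioo.mem_nhds (hmem s hs)] with y hy using FG y hy
      exact h1.comp s ((hF s).hasDerivAt.const_mul κ)
    · rw [hI]
      have := (gpos (G (κ * F s))).ne'
      change g s = 2 * F t / Z * (g (G (κ * F s)) * _)
      have h3 : 2 * F t / Z * κ = 1 := by rw [hκ]; field_simp
      calc g s = (2 * F t / Z * κ) * (g (G (κ * F s)) * (g (G (κ * F s)))⁻¹) * g s := by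
            rw [h3, mul_inv_cancel₀ this]; ring
        _ = _ := by ring
  · intro a ha b hb hab
    have h1 := Fmono hab
    refine Fmono.lt_iff_lt.1 ?_
    simp only
    rw [hFφ a ha, hFφ b hb]
    nlinarith
  · intro s hs
    have hs' : -s ∈ Set.Ioo (-t) t := ⟨by linarith [hs.2], by linarith [hs.1]⟩
    refine Fmono.injective ?_
    simp only
    rw [hFφ _ hs', Fodd, Fodd, hFφ _ hs]; ring
  · intro M
    let m := max M 1
    have hm : 0 < F m := by rw [← F0]; exact Fmono (by simp [m])
    obtain ⟨s, hs, hs2⟩ := intermediate_value_Ioo ht.le (Fc.continuousOn (s := Set.Icc 0 t))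
      (show F m / κ ∈ Set.Ioo (F 0) (F t) by
        rw [F0]
        refine ⟨by positivity, ?_⟩
        rw [div_lt_iff₀ κpos, mul_comm, κF]; exact Flt m)
    refine ⟨s, hs, ?_⟩
    simp only
    rw [hs2, mul_div_cancel₀ _ κpos.ne', GF]
    exact le_max_left _ _

theorem jb_sum_sq {n : ℕ} {ι : Type} [Fintype ι] {c : ι → ℝ} {u : ι → EuclideanSpace ℝ (Fin n)}
    (hid : ∀ x, ∑ i, (c i * ⟪u i, x⟫) • u i = x) (x : EuclideanSpace ℝ (Fin n)) :
    ∑ i, c i * ⟪u i, x⟫ ^ 2 = ‖x‖ ^ 2 := by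
  rw [← real_inner_self_eq_norm_sq]
  conv_rhs => lhs; rw [← hid x]
  rw [sum_inner]
  refine Finset.sum_congr rfl fun i _ => ?_
  rw [real_inner_smul_left]; ring

theorem jb_det {n : ℕ} {ι : Type} [Fintype ι] {c : ι → ℝ} {u : ι → EuclideanSpace ℝ (Fin n)}
    (hc : ∀ i, 0 < c i) (hu : ∀ i, ‖u i‖ = 1)
    (hid : ∀ x, ∑ i, (c i * ⟪u i, x⟫) • u i = x) (l : ι → ℝ) (hl : ∀ i, 0 < l i)
    (A : EuclideanSpace ℝ (Fin n) →L[ℝ] EuclideanSpace ℝ (Fin n))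
    (hA : ∀ x, A x = ∑ i, (c i * (l i * ⟪u i, x⟫)) • u i) :
    ∏ i, l i ^ c i ≤ A.det := by
  have hsym : (A : EuclideanSpace ℝ (Fin n) →ₗ[ℝ] EuclideanSpace ℝ (Fin n)).IsSymmetric := by
    intro x y
    simp only [ContinuousLinearMap.coe_coe, hA, sum_inner, inner_sum, real_inner_smul_left, real_inner_smul_right]
    refine Finset.sum_congr rfl fun i _ => ?_
    rw [real_inner_comm (u i) x]; ring
  have hn : Module.finrank ℝ (EuclideanSpace ℝ (Fin n)) = n := by simp
  let e := hsym.eigenvectorBasis hn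
  have hdet : A.det = ∏ k, hsym.eigenvalues hn k := by
    have := hsym.det_eq_prod_eigenvalues hn
    simpa using this
  have hone : ∀ k, ∑ i, c i * ⟪u i, e k⟫ ^ 2 = 1 := fun k => by
    rw [jb_sum_sq hid, e.norm_eq_one]; norm_num
  have hev : ∀ k, hsym.eigenvalues hn k = ∑ i, (c i * ⟪u i, e k⟫ ^ 2) * l i := by
    intro k
    have h1 : A (e k) = hsym.eigenvalues hn k • e k := by
      exact hsym.apply_eigenvectorBasis hn k
    have h2 : ⟪A (e k), e k⟫ = hsym.eigenvalues hn k := by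
      rw [h1, real_inner_smul_left, real_inner_self_eq_norm_sq, e.norm_eq_one]; ring
    rw [← h2, hA, sum_inner]
    refine Finset.sum_congr rfl fun i _ => ?_
    rw [real_inner_smul_left]; ring
  have hk : ∀ k, ∏ i, l i ^ (c i * ⟪u i, e k⟫ ^ 2) ≤ hsym.eigenvalues hn k := by
    intro k
    rw [hev]
    exact Real.geom_mean_le_arith_mean_weighted _ _ _ (fun i _ => mul_nonneg (hc i).le (sq_nonneg _)) (hone k) (fun i _ => (hl i).le)
  rw [hdet]
  calc ∏ i, l i ^ c i = ∏ k, ∏ i, l i ^ (c i * ⟪u i, e k⟫ ^ 2) := by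
        rw [Finset.prod_comm]
        refine Finset.prod_congr rfl fun i _ => ?_
        rw [← Real.rpow_sum_of_pos (hl i), ← Finset.mul_sum]
        have : ∑ k, ⟪u i, e k⟫ ^ 2 = 1 := by
          have := e.sum_sq_norm_inner_left (u i)
          simpa [hu i] using this
        rw [this, mul_one]
    _ ≤ _ := Finset.prod_le_prod (fun k _ => Finset.prod_nonneg fun i _ => Real.rpow_nonneg (hl i).le _) (fun k _ => hk k)

theorem jb_sum_c {n : ℕ} {ι : Type} [Fintype ι] {c : ι → ℝ} {u : ι → EuclideanSpace ℝ (Fin n)}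
    (hu : ∀ i, ‖u i‖ = 1)
    (hid : ∀ x, ∑ i, (c i * ⟪u i, x⟫) • u i = x) : ∑ i, c i = n := by
  let e := EuclideanSpace.basisFun (Fin n) ℝ
  have h1 : ∑ k, ∑ i, c i * ⟪u i, e k⟫ ^ 2 = n := by
    simp [jb_sum_sq hid]
  rw [← h1, Finset.sum_comm]
  refine Finset.sum_congr rfl fun i _ => ?_
  rw [← Finset.mul_sum]
  have : ∑ k, ⟪u i, e k⟫ ^ 2 = 1 := by
    have := e.sum_sq_norm_inner_left (u i)
    simpa [hu i] using this
  rw [this, mul_one]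

theorem jb_prob (n : ℕ) : IsProbabilityMeasure (gaussianMeasure n) := by
  constructor
  rw [gaussianMeasure, withDensity_apply _ MeasurableSet.univ, Measure.restrict_univ]
  have h := GaussianFourier.integral_rexp_neg_mul_sq_norm (V := EuclideanSpace ℝ (Fin n)) (b := 1/2) (by norm_num)
  have hf : (fun x : EuclideanSpace ℝ (Fin n) => Real.exp (-‖x‖ ^ 2 / 2)) = fun x => Real.exp (-(1/2) * ‖x‖^2) := by
    funext x; congr 1; ring
  have hp : (0:ℝ) < (2 * Real.pi) ^ ((n:ℝ) / 2) := by positivity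
  have h2 : ∫ x : EuclideanSpace ℝ (Fin n), Real.exp (-‖x‖ ^ 2 / 2) = (2 * Real.pi) ^ ((n:ℝ) / 2) := by
    rw [hf, h]; simp [mul_comm]
  have hExpInt : Integrable (fun x : EuclideanSpace ℝ (Fin n) => Real.exp (-‖x‖ ^ 2 / 2)) := by
    by_contra hn
    rw [integral_undef hn] at h2
    linarith
  rw [← ofReal_integral_eq_lintegral_ofReal (hExpInt.const_mul _) (Filter.Eventually.of_forall fun x => by positivity)]
  rw [integral_const_mul, h2, ← Real.rpow_add (by positivity)]
  simp [neg_div]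

theorem jb_alg {n : ℕ} {ι : Type} [Fintype ι] {c : ι → ℝ} {u : ι → EuclideanSpace ℝ (Fin n)}
    (hid : ∀ x, ∑ i, (c i * ⟪u i, x⟫) • u i = x) (a : ι → ℝ) (y : EuclideanSpace ℝ (Fin n))
    (hy : y = ∑ i, (c i * a i) • u i) :
    ∑ i, c i * (a i - ⟪u i, y⟫) ^ 2 = ∑ i, c i * a i ^ 2 - ‖y‖ ^ 2 := by
  have h1 := jb_sum_sq hid y
  have h2 : ∑ i, c i * a i * ⟪u i, y⟫ = ‖y‖ ^ 2 := by
    rw [← real_inner_self_eq_norm_sq]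
    conv_rhs => lhs; rw [hy]
    rw [sum_inner]
    refine Finset.sum_congr rfl fun i _ => ?_
    rw [real_inner_smul_left]
  have : ∑ i, c i * (a i - ⟪u i, y⟫) ^ 2 = ∑ i, c i * a i ^ 2 - 2 * ∑ i, c i * a i * ⟪u i, y⟫ + ∑ i, c i * ⟪u i, y⟫ ^ 2 := by
    rw [Finset.mul_sum, ← Finset.sum_sub_distrib, ← Finset.sum_add_distrib]
    refine Finset.sum_congr rfl fun i _ => by ring
  rw [this, h1, h2]; ring

theorem jb_BL {n : ℕ} {ι : Type} [Fintype ι] {c : ι → ℝ} {u : ι → EuclideanSpace ℝ (Fin n)}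
    (hc : ∀ i, 0 < c i) (hu : ∀ i, ‖u i‖ = 1)
    (hid : ∀ x, ∑ i, (c i * ⟪u i, x⟫) • u i = x) (t : ℝ) (ht : 0 < t) :
    gaussianMeasure n {x | ∀ i, |⟪u i, x⟫| < t} ≤
      ENNReal.ofReal (((∫ x in (-t)..t, Real.exp (-x ^ 2 / 2)) / √(2 * Real.pi)) ^ n) ∧
    (ENNReal.ofReal (((∫ x in (-t)..t, Real.exp (-x ^ 2 / 2)) / √(2 * Real.pi)) ^ n) ≤
      gaussianMeasure n {x | ∀ i, |⟪u i, x⟫| < t} →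
      ∀ i j, ⟪u i, u j⟫ = 0 ∨ ⟪u i, u j⟫ = 1 ∨ ⟪u i, u j⟫ = -1) := by
  have := jb_prob n
  obtain ⟨φ, φ', hφ, hmono, hodd, hunb⟩ := jb_phi t ht
  set r := (∫ x in (-t)..t, Real.exp (-x ^ 2 / 2)) / √(2 * Real.pi) with hr
  have hrpos : 0 < r := by
    refine div_pos ?_ (Real.sqrt_pos.2 (by positivity))
    exact intervalIntegral.intervalIntegral_pos_of_pos (Continuous.intervalIntegrable (by fun_prop) _ _)
      (fun x => Real.exp_pos _) (by linarith)
  set U : Set (EuclideanSpace ℝ (Fin n)) := {x | ∀ i, |⟪u i, x⟫| < t} with hU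
  have hUopen : IsOpen U := by
    have : U = ⋂ i, {x | |⟪u i, x⟫| < t} := by ext; simp [hU]
    rw [this]
    exact isOpen_iInter_of_finite fun i => isOpen_lt (by fun_prop) continuous_const
  have hUmem : ∀ x ∈ U, ∀ i, ⟪u i, x⟫ ∈ Set.Ioo (-t) t := fun x hx i => abs_lt.1 (hx i)
  let Φ : EuclideanSpace ℝ (Fin n) → EuclideanSpace ℝ (Fin n) := fun x => ∑ i, (c i * φ ⟪u i, x⟫) • u i
  let Φ' : EuclideanSpace ℝ (Fin n) → EuclideanSpace ℝ (Fin n) →L[ℝ] EuclideanSpace ℝ (Fin n) :=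
    fun x => ∑ i, ((c i * φ' ⟪u i, x⟫) • innerSL ℝ (u i)).smulRight (u i)
  have hΦ'app : ∀ x y, Φ' x y = ∑ i, (c i * (φ' ⟪u i, x⟫ * ⟪u i, y⟫)) • u i := by
    intro x y
    simp [Φ', mul_assoc]
  have hderiv : ∀ x ∈ U, HasFDerivAt Φ (Φ' x) x := by
    intro x hx
    refine HasFDerivAt.fun_sum fun i _ => ?_
    have h1 : HasFDerivAt (fun y => φ ⟪u i, y⟫) (φ' ⟪u i, x⟫ • innerSL ℝ (u i)) x :=
      ((hφ _ (hUmem x hx i)).1).comp_hasFDerivAt x (innerSL ℝ (u i)).hasFDerivAt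
    have h2 := (h1.const_mul (c i)).smul_const (u i)
    rw [smul_smul] at h2
    exact h2
  have hΦc : ContinuousOn Φ U := fun x hx => (hderiv x hx).continuousAt.continuousWithinAt
  have hinj : Set.InjOn Φ U := by
    intro x hx y hy hxy
    have h1 : ⟪Φ x - Φ y, x - y⟫ = ∑ i, c i * ((φ ⟪u i, x⟫ - φ ⟪u i, y⟫) * (⟪u i, x⟫ - ⟪u i, y⟫)) := by
      simp only [Φ, ← Finset.sum_sub_distrib, sum_inner, ← sub_smul, real_inner_smul_left, inner_sub_right]
      refine Finset.sum_congr rfl fun i _ => by ring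
    rw [hxy, sub_self, inner_zero_left] at h1
    have hpos : ∀ i, 0 ≤ (φ ⟪u i, x⟫ - φ ⟪u i, y⟫) * (⟪u i, x⟫ - ⟪u i, y⟫) ∧
        ((φ ⟪u i, x⟫ - φ ⟪u i, y⟫) * (⟪u i, x⟫ - ⟪u i, y⟫) = 0 → ⟪u i, x⟫ = ⟪u i, y⟫) := by
      intro i
      rcases lt_trichotomy ⟪u i, x⟫ ⟪u i, y⟫ with h | h | h
      · have := hmono (hUmem x hx i) (hUmem y hy i) h
        have h3 := mul_pos_of_neg_of_neg (sub_neg.2 this) (sub_neg.2 h)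
        exact ⟨h3.le, fun h4 => absurd h4 h3.ne'⟩
      · simp [h]
      · have := hmono (hUmem y hy i) (hUmem x hx i) h
        have h3 := mul_pos (sub_pos.2 this) (sub_pos.2 h)
        exact ⟨h3.le, fun h4 => absurd h4 h3.ne'⟩
    have h2 := (Finset.sum_eq_zero_iff_of_nonneg (fun i _ => mul_nonneg (hc i).le (hpos i).1)).1 h1.symm
    have h3 : ∀ i, ⟪u i, x⟫ = ⟪u i, y⟫ := fun i =>
      (hpos i).2 ((mul_eq_zero.1 (h2 i (Finset.mem_univ _))).resolve_left (hc i).ne')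
    rw [← hid x, ← hid y]; simp only [h3]
  let D : EuclideanSpace ℝ (Fin n) → ℝ := fun x => (2 * Real.pi) ^ (-(n : ℝ) / 2) * Real.exp (-‖x‖ ^ 2 / 2)
  have hDc : Continuous D := by fun_prop
  have hDpos : ∀ x, 0 < D x := fun x => by positivity
  have hΦsq : ∀ x, ‖Φ x‖^2 ≤ ∑ i, c i * φ ⟪u i, x⟫ ^ 2 := by
    intro x
    have := jb_alg hid (fun i => φ ⟪u i, x⟫) (Φ x) rfl
    have h2 : 0 ≤ ∑ i, c i * (φ ⟪u i, x⟫ - ⟪u i, Φ x⟫) ^ 2 :=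
      Finset.sum_nonneg fun i _ => mul_nonneg (hc i).le (sq_nonneg _)
    linarith
  have hdet : ∀ x ∈ U, ∏ i, φ' ⟪u i, x⟫ ^ c i ≤ (Φ' x).det := fun x hx =>
    jb_det hc hu hid (fun i => φ' ⟪u i, x⟫) (fun i => (hφ _ (hUmem x hx i)).2.1) (Φ' x) (hΦ'app x)
  have hprodpos : ∀ x ∈ U, 0 < ∏ i, φ' ⟪u i, x⟫ ^ c i := fun x hx =>
    Finset.prod_pos fun i _ => Real.rpow_pos_of_pos (hφ _ (hUmem x hx i)).2.1 _
  have hD1 : ∀ x ∈ U, Real.exp (-‖x‖ ^ 2 / 2) =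
      r ^ n * (Real.exp (-(∑ i, c i * φ ⟪u i, x⟫ ^ 2) / 2) * ∏ i, φ' ⟪u i, x⟫ ^ c i) := by
    intro x hx
    have h1 : Real.exp (-‖x‖ ^ 2 / 2) = ∏ i, Real.exp (-⟪u i, x⟫ ^ 2 / 2) ^ c i := by
      rw [← jb_sum_sq hid x]
      simp only [← Real.exp_mul]
      rw [← Real.exp_sum, ← Finset.sum_neg_distrib, Finset.sum_div]
      congr 1
      refine Finset.sum_congr rfl fun i _ => by ring
    have h2 : Real.exp (-(∑ i, c i * φ ⟪u i, x⟫ ^ 2) / 2) = ∏ i, Real.exp (-(φ ⟪u i, x⟫) ^ 2 / 2) ^ c i := by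
      simp only [← Real.exp_mul]
      rw [← Real.exp_sum, ← Finset.sum_neg_distrib, Finset.sum_div]
      congr 1
      refine Finset.sum_congr rfl fun i _ => by ring
    have h3 : r ^ n = ∏ i, r ^ c i := by
      rw [← Real.rpow_sum_of_pos hrpos, jb_sum_c hu hid, Real.rpow_natCast]
    rw [h1, h2, h3, ← Finset.prod_mul_distrib, ← Finset.prod_mul_distrib]
    refine Finset.prod_congr rfl fun i _ => ?_
    obtain ⟨-, hp, heq⟩ := hφ _ (hUmem x hx i)
    rw [heq, Real.mul_rpow hrpos.le (by positivity), Real.mul_rpow (by positivity) hp.le]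
  have hle : ∀ x ∈ U, D x ≤ r ^ n * (|(Φ' x).det| * D (Φ x)) ∧
      (D x = r ^ n * (|(Φ' x).det| * D (Φ x)) → ‖Φ x‖^2 = ∑ i, c i * φ ⟪u i, x⟫ ^ 2) := by
    intro x hx
    have hP := hprodpos x hx
    have hd := (hdet x hx).trans (le_abs_self _)
    have hZ : (0:ℝ) < (2 * Real.pi) ^ (-(n : ℝ) / 2) := by positivity
    have hrn : 0 < r ^ n := by positivity
    have hs := hΦsq x
    simp only [D]
    rw [hD1 x hx]
    set S := ∑ i, c i * φ ⟪u i, x⟫ ^ 2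
    set P := ∏ i, φ' ⟪u i, x⟫ ^ c i
    set d := |(Φ' x).det|
    set z := (2 * Real.pi) ^ (-(n : ℝ) / 2)
    have he : Real.exp (-S/2) ≤ Real.exp (-‖Φ x‖ ^ 2 / 2) := Real.exp_le_exp.2 (by linarith)
    have hmain : Real.exp (-S/2) * P ≤ d * Real.exp (-‖Φ x‖ ^ 2 / 2) := by
      rw [mul_comm d]
      exact mul_le_mul he hd hP.le (Real.exp_pos _).le
    have e1 : z * (r ^ n * (Real.exp (-S/2) * P)) = (r ^ n * z) * (Real.exp (-S/2) * P) := by ring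
    have e2 : r ^ n * (d * (z * Real.exp (-‖Φ x‖ ^ 2 / 2))) = (r ^ n * z) * (d * Real.exp (-‖Φ x‖ ^ 2 / 2)) := by ring
    rw [e1, e2]
    refine ⟨mul_le_mul_of_nonneg_left hmain (by positivity), fun h => ?_⟩
    have h4 := mul_left_cancel₀ (by positivity) h
    by_contra hne
    have hlt : ‖Φ x‖^2 < S := lt_of_le_of_ne hs hne
    have he2 : Real.exp (-S/2) < Real.exp (-‖Φ x‖ ^ 2 / 2) := Real.exp_lt_exp.2 (by linarith)
    have : Real.exp (-S/2) * P < Real.exp (-‖Φ x‖ ^ 2 / 2) * d := mul_lt_mul he2 hd hP (Real.exp_pos _).le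
    linarith
  have hγ : ∀ s, MeasurableSet s → gaussianMeasure n s = ∫⁻ x in s, ENNReal.ofReal (D x) := fun s hs => by
    rw [gaussianMeasure, withDensity_apply _ hs]
  have hUm : MeasurableSet U := hUopen.measurableSet
  let R : EuclideanSpace ℝ (Fin n) → ENNReal := fun x =>
    ENNReal.ofReal (r ^ n) * (ENNReal.ofReal |(Φ' x).det| * ENNReal.ofReal (D (Φ x)))
  have hReq : ∀ x, R x = ENNReal.ofReal (r ^ n * (|(Φ' x).det| * D (Φ x))) := fun x => by
    rw [ENNReal.ofReal_mul (by positivity), ENNReal.ofReal_mul (by positivity)]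
  have hdw : ∀ x ∈ U, HasFDerivWithinAt Φ (Φ' x) U x := fun x hx => (hderiv x hx).hasFDerivWithinAt
  have hRint : ∫⁻ x in U, R x ≤ ENNReal.ofReal (r ^ n) := by
    simp only [R]
    rw [lintegral_const_mul' _ _ ENNReal.ofReal_ne_top,
      ← lintegral_image_eq_lintegral_abs_det_fderiv_mul volume hUm hdw hinj (fun y => ENNReal.ofReal (D y)),
      ← hγ _ (measurable_image_of_fderivWithin hUm hdw hinj)]
    exact mul_le_of_le_one_right (zero_le) prob_le_one
  have hleR : ∀ x ∈ U, ENNReal.ofReal (D x) ≤ R x := fun x hx => by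
    rw [hReq]; exact ENNReal.ofReal_le_ofReal (hle x hx).1
  have hIntLe : ∫⁻ x in U, ENNReal.ofReal (D x) ≤ ∫⁻ x in U, R x :=
    setLIntegral_mono' hUm hleR
  refine ⟨by rw [hγ U hUm]; exact hIntLe.trans hRint, fun hge i₀ j => ?_⟩
  have hRm : AEMeasurable R (volume.restrict U) := by
    have h1 := aemeasurable_ofReal_abs_det_fderivWithin volume hUm hdw
    have h2 := ((hDc.comp_continuousOn hΦc).aemeasurable (μ := volume) hUm).ennreal_ofReal
    exact (h1.mul h2).const_mul _
  have hae : (fun x => ENNReal.ofReal (D x)) =ᵐ[volume.restrict U] R := by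
    refine ae_eq_of_ae_le_of_lintegral_le ?_ ?_ hRm ?_
    · exact (ae_restrict_iff' hUm).2 (Filter.Eventually.of_forall hleR)
    · rw [← hγ U hUm]; exact measure_ne_top _ _
    · rw [← hγ U hUm]; exact hRint.trans hge
  have hae2 : (fun x => ‖Φ x‖^2) =ᵐ[volume.restrict U] (fun x => ∑ i, c i * φ ⟪u i, x⟫ ^ 2) := by
    filter_upwards [hae, ae_restrict_mem hUm] with x hx hxU
    refine (hle x hxU).2 ?_
    simp only [hReq] at hx
    exact (ENNReal.ofReal_eq_ofReal_iff (hDpos x).le (mul_nonneg (by positivity) (mul_nonneg (abs_nonneg _) (hDpos _).le))).1 hx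
  have heqOn : Set.EqOn (fun x => ‖Φ x‖^2) (fun x => ∑ i, c i * φ ⟪u i, x⟫ ^ 2) U := by
    refine Measure.eqOn_open_of_ae_eq hae2 hUopen (hΦc.norm.pow 2) ?_
    refine continuousOn_finsetSum _ fun i _ => ContinuousOn.mul continuousOn_const (ContinuousOn.pow ?_ 2)
    intro x hx
    have h1 : ContinuousAt φ ⟪u i, x⟫ := (hφ _ (hUmem x hx i)).1.continuousAt
    exact (ContinuousAt.comp (f := fun y => ⟪u i, y⟫) (g := φ) h1 (by fun_prop)).continuousWithinAt
  have hkey : ∀ x ∈ U, ∀ i, φ ⟪u i, x⟫ = ⟪u i, Φ x⟫ := by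
    intro x hx i
    have h1 := jb_alg hid (fun i => φ ⟪u i, x⟫) (Φ x) rfl
    have h2 : ‖Φ x‖^2 = ∑ i, c i * φ ⟪u i, x⟫ ^ 2 := heqOn hx
    rw [h2, sub_self] at h1
    have h3 := (Finset.sum_eq_zero_iff_of_nonneg (fun i _ => mul_nonneg (hc i).le (sq_nonneg _))).1 h1 i (Finset.mem_univ _)
    have h4 := (mul_eq_zero.1 h3).resolve_left (hc i).ne'
    have := pow_eq_zero_iff (two_ne_zero) |>.1 h4
    linarith
  -- equality analysis
  let a : ι → ℝ := fun i => ⟪u i, u j⟫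
  have ha1 : ∀ i, |a i| ≤ 1 := fun i => by
    have := abs_real_inner_le_norm (u i) (u j)
    rwa [hu, hu, one_mul] at this
  have hasq : ∑ i, c i * a i ^ 2 = 1 := by
    have := jb_sum_sq hid (u j)
    rw [hu] at this; simpa using this
  by_contra hcon
  push Not at hcon
  obtain ⟨hc0, hc1, hc2⟩ := hcon
  -- choose s
  obtain ⟨s, hs, hsM⟩ := hunb (1 + ∑ i, |φ (t * |a i|)| / |a i|)
  have hs1 : s ∈ Set.Ioo (-t) t := ⟨by linarith [hs.1], hs.2⟩
  have hsU : s • u j ∈ U := by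
    intro i
    rw [real_inner_smul_right, abs_mul, abs_of_pos hs.1]
    nlinarith [ha1 i, hs.1, hs.2]
  have h1 := hkey _ hsU j
  have h2 : ⟪u j, Φ (s • u j)⟫ = ∑ i, c i * (φ (s * a i) * a i) := by
    simp only [Φ, inner_sum, real_inner_smul_right]
    refine Finset.sum_congr rfl fun i _ => ?_
    rw [real_inner_comm (u i) (u j)]; simp only [a]; ring
  rw [h2, real_inner_smul_right, real_inner_self_eq_norm_sq, hu] at h1
  have h3 : ∑ i, c i * (a i * (a i * φ s) - φ (s * a i) * a i) = 0 := by
    simp only [mul_sub, Finset.sum_sub_distrib]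
    rw [← h1]
    have : ∑ i, c i * (a i * (a i * φ s)) = (∑ i, c i * a i ^ 2) * φ s := by
      rw [Finset.sum_mul]; exact Finset.sum_congr rfl fun i _ => by ring
    rw [this, hasq]; simp
  have hterm : ∀ i, a i * (a i * φ s) - φ (s * a i) * a i = |a i| * (|a i| * φ s - φ (s * |a i|)) := by
    intro i
    rcases abs_choice (a i) with h | h
    · rw [h]; ring
    · rw [h]
      have hmem : s * a i ∈ Set.Ioo (-t) t := by
        have := hUmem _ hsU i
        rwa [real_inner_smul_right] at this
      rw [show s * -(a i) = -(s * a i) by ring, hodd _ hmem]; ring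
  have hpos : ∀ i, a i ≠ 0 → |a i| ≠ 1 → 0 < |a i| * (|a i| * φ s - φ (s * |a i|)) := by
    intro i h0 h1'
    have hap : 0 < |a i| := abs_pos.2 h0
    have halt : |a i| < 1 := lt_of_le_of_ne (ha1 i) h1'
    have hm1 : φ (s * |a i|) < φ (t * |a i|) := by
      refine hmono ⟨?_, ?_⟩ ⟨?_, ?_⟩ ?_ <;> nlinarith [hs.1, hs.2]
    have hm2 : |φ (t * |a i|)| / |a i| ≤ ∑ i, |φ (t * |a i|)| / |a i| :=
      Finset.single_le_sum (f := fun i => |φ (t * |a i|)| / |a i|) (fun i _ => by positivity) (Finset.mem_univ i)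
    have hm3 : |φ (t * |a i|)| / |a i| < φ s := by linarith
    rw [div_lt_iff₀ hap] at hm3
    have := le_abs_self (φ (t * |a i|))
    refine mul_pos hap ?_
    linarith
  have hnonneg : ∀ i, 0 ≤ |a i| * (|a i| * φ s - φ (s * |a i|)) := by
    intro i
    by_cases h0 : a i = 0
    · simp [h0]
    by_cases h1' : |a i| = 1
    · simp [h1']
    exact (hpos i h0 h1').le
  simp only [hterm] at h3
  have h4 := (Finset.sum_eq_zero_iff_of_nonneg (fun i _ => mul_nonneg (hc i).le (hnonneg i))).1 h3 i₀ (Finset.mem_univ _)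
  have h5 : |a i₀| ≠ 1 := by
    intro h
    rcases (abs_eq (by norm_num)).1 h with h | h
    · exact hc1 h
    · exact hc2 h
  have h6 := mul_pos (hc i₀) (hpos i₀ hc0 h5)
  linarith


theorem jb_cube (n : ℕ) (t : ℝ) (ht : 0 < t) :
    gaussianMeasure n {x | ∀ i, |x i| < t} =
      ENNReal.ofReal (((∫ x in (-t)..t, Real.exp (-x ^ 2 / 2)) / √(2 * Real.pi)) ^ n) := by
  have := jb_prob n
  set f : ℝ → ℝ := (Set.Ioo (-t) t).indicator (fun s => Real.exp (-s ^ 2 / 2) / √(2 * Real.pi)) with hf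
  set D : EuclideanSpace ℝ (Fin n) → ℝ := fun x => (2 * Real.pi) ^ (-(n : ℝ) / 2) * Real.exp (-‖x‖ ^ 2 / 2) with hD
  have hfint : ∫ s, f s = (∫ x in (-t)..t, Real.exp (-x ^ 2 / 2)) / √(2 * Real.pi) := by
    rw [hf, integral_indicator measurableSet_Ioo, ← integral_Ioc_eq_integral_Ioo,
      ← intervalIntegral.integral_of_le (by linarith), intervalIntegral.integral_div]
  have hUm : MeasurableSet {x : EuclideanSpace ℝ (Fin n) | ∀ i, |x i| < t} := by
    have : {x : EuclideanSpace ℝ (Fin n) | ∀ i, |x i| < t} = ⋂ i, {x | |x i| < t} := by ext; simp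
    rw [this]
    exact (isOpen_iInter_of_finite fun i => isOpen_lt (by fun_prop) continuous_const).measurableSet
  have hDf : ∀ x, {x : EuclideanSpace ℝ (Fin n) | ∀ i, |x i| < t}.indicator D x = ∏ i, f (x i) := by
    intro x
    by_cases hx : ∀ i, |x i| < t
    · rw [Set.indicator_of_mem (show x ∈ {x : EuclideanSpace ℝ (Fin n) | ∀ i, |x i| < t} from hx)]
      have : ∀ i, f (x i) = Real.exp (-(x i) ^ 2 / 2) / √(2 * Real.pi) := fun i =>
        Set.indicator_of_mem (show x i ∈ Set.Ioo (-t) t from abs_lt.1 (hx i)) _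
      simp only [this, hD]
      rw [Finset.prod_div_distrib, ← Real.exp_sum, Finset.prod_const, Finset.card_univ, Fintype.card_fin,
        EuclideanSpace.norm_sq_eq, ← Finset.sum_div, Finset.sum_neg_distrib, Real.sqrt_eq_rpow,
        ← Real.rpow_natCast, ← Real.rpow_mul (by positivity), neg_div, Real.rpow_neg (by positivity)]
      simp only [Real.norm_eq_abs, sq_abs]
      rw [one_div, inv_mul_eq_div, inv_mul_eq_div]
    · rw [Set.indicator_of_notMem (show x ∉ {x : EuclideanSpace ℝ (Fin n) | ∀ i, |x i| < t} from hx)]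
      push Not at hx
      obtain ⟨i, hi⟩ := hx
      symm
      refine Finset.prod_eq_zero (Finset.mem_univ i) ?_
      exact Set.indicator_of_notMem (show x i ∉ Set.Ioo (-t) t from fun h => absurd (abs_lt.2 h) (not_lt.2 hi)) _
  have hDc : Continuous D := by fun_prop
  have hDpos : ∀ x, 0 ≤ D x := fun x => by positivity
  have e1 : gaussianMeasure n {x | ∀ i, |x i| < t} = ∫⁻ x in {x : EuclideanSpace ℝ (Fin n) | ∀ i, |x i| < t}, ENNReal.ofReal (D x) := by
    rw [gaussianMeasure, withDensity_apply _ hUm]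
  have e2 : ∫ x in {x : EuclideanSpace ℝ (Fin n) | ∀ i, |x i| < t}, D x = (∫ s, f s) ^ n := by
    rw [← integral_indicator hUm]
    simp only [hDf]
    rw [← (EuclideanSpace.volume_preserving_symm_measurableEquiv_toLp (Fin n)).symm.integral_comp']
    have := integral_fintype_prod_volume_eq_pow (ι := Fin n) f
    simpa using this
  rw [← hfint, ← e2, integral_eq_lintegral_of_nonneg_ae (Filter.Eventually.of_forall hDpos) hDc.aestronglyMeasurable,
    ← e1, ENNReal.ofReal_toReal (measure_ne_top _ _)]

theorem jb_integrable_norm (n : ℕ) : Integrable (fun x => ‖x‖) (gaussianMeasure n) := by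
  rw [gaussianMeasure, integrable_withDensity_iff (by fun_prop) (Filter.Eventually.of_forall fun x => ENNReal.ofReal_lt_top)]
  have h := GaussianFourier.integral_rexp_neg_mul_sq_norm (V := EuclideanSpace ℝ (Fin n)) (b := 1/4) (by norm_num)
  have hExpInt : Integrable (fun x : EuclideanSpace ℝ (Fin n) => Real.exp (-(1/4) * ‖x‖ ^ 2)) := by
    by_contra hn
    rw [integral_undef hn] at h
    have : (0:ℝ) < (Real.pi / (1/4)) ^ ((Module.finrank ℝ (EuclideanSpace ℝ (Fin n)) : ℝ) / 2) := by positivity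
    linarith
  refine (hExpInt.const_mul ((2 * Real.pi) ^ (-(n : ℝ) / 2))).mono' (Measurable.aestronglyMeasurable (by fun_prop)) (Filter.Eventually.of_forall fun x => ?_)
  rw [ENNReal.toReal_ofReal (by positivity), Real.norm_of_nonneg (by positivity), mul_left_comm]
  refine mul_le_mul_of_nonneg_left ?_ (by positivity)
  have h1 : ‖x‖ ≤ Real.exp (‖x‖ ^ 2 / 4) := by
    have := Real.add_one_le_exp (‖x‖ ^ 2 / 4)
    nlinarith [sq_nonneg (‖x‖ / 2 - 1)]
  calc ‖x‖ * Real.exp (-‖x‖ ^ 2 / 2) ≤ Real.exp (‖x‖ ^ 2 / 4) * Real.exp (-‖x‖ ^ 2 / 2) := by gcongr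
    _ = _ := by rw [← Real.exp_add]; congr 1; ring

theorem jb_gauge {n : ℕ} {K : Set (EuclideanSpace ℝ (Fin n))} (hc : Convex ℝ K)
    (hK1 : Metric.closedBall 0 1 ⊆ K) :
    Continuous (gauge K) ∧ (∀ x, gauge K x ≤ ‖x‖) ∧ Integrable (gauge K) (gaussianMeasure n) := by
  have hn : K ∈ nhds (0 : EuclideanSpace ℝ (Fin n)) :=
    Filter.mem_of_superset (Metric.closedBall_mem_nhds _ one_pos) hK1
  have hcont := continuous_gauge hc hn
  have hle : ∀ x, gauge K x ≤ ‖x‖ := by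
    intro x
    have := mul_gauge_le_norm (s := K) (r := 1) (x := x) (Metric.ball_subset_closedBall.trans hK1)
    simpa using this
  refine ⟨hcont, hle, (jb_integrable_norm n).mono' hcont.aestronglyMeasurable (Filter.Eventually.of_forall fun x => ?_)⟩
  rw [Real.norm_of_nonneg (gauge_nonneg x)]
  exact hle x

theorem jb_layer {n : ℕ} {K : Set (EuclideanSpace ℝ (Fin n))} (hc : Convex ℝ K)
    (hK1 : Metric.closedBall 0 1 ⊆ K) :
    ENNReal.ofReal (ellNorm K) = ∫⁻ t in Set.Ioi 0, gaussianMeasure n {x | t ≤ gauge K x} := by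
  obtain ⟨h1, h2, h3⟩ := jb_gauge hc hK1
  rw [ellNorm, ofReal_integral_eq_lintegral_ofReal h3 (Filter.Eventually.of_forall fun x => gauge_nonneg x)]
  exact lintegral_eq_lintegral_meas_le _ (Filter.Eventually.of_forall fun x => gauge_nonneg x) h1.aemeasurable

theorem jb_compl {n : ℕ} {K : Set (EuclideanSpace ℝ (Fin n))} (hc : Convex ℝ K)
    (hK1 : Metric.closedBall 0 1 ⊆ K) (t : ℝ) :
    gaussianMeasure n {x | t ≤ gauge K x} = 1 - gaussianMeasure n {x | gauge K x < t} := by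
  have := jb_prob n
  obtain ⟨h1, h2, h3⟩ := jb_gauge hc hK1
  have e : {x | t ≤ gauge K x} = {x | gauge K x < t}ᶜ := by ext; simp
  rw [e, prob_compl_eq_one_sub (isOpen_lt h1 continuous_const).measurableSet]

theorem jb_unitCube_convex (n : ℕ) : Convex ℝ (unitCube n) := by
  have : unitCube n = ⋂ i, {x : EuclideanSpace ℝ (Fin n) | |x i| ≤ 1} := by ext; simp [unitCube]
  rw [this]
  refine convex_iInter fun i => ?_
  have : {x : EuclideanSpace ℝ (Fin n) | |x i| ≤ 1} = (EuclideanSpace.proj (𝕜 := ℝ) i) ⁻¹' (Set.Icc (-1) 1) := by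
    ext x; simp [abs_le]
  rw [this]
  exact (convex_Icc (-1 : ℝ) 1).linear_preimage (EuclideanSpace.proj (𝕜 := ℝ) i : EuclideanSpace ℝ (Fin n) →L[ℝ] ℝ).toLinearMap

theorem jb_unitCube_ball (n : ℕ) : Metric.closedBall 0 1 ⊆ unitCube n := by
  intro x hx i
  have h1 : ‖x‖ ≤ 1 := by simpa using hx
  have := EuclideanSpace.norm_sq_eq x
  have h2 : ‖x i‖ ^ 2 ≤ ∑ i, ‖x i‖ ^ 2 := Finset.single_le_sum (f := fun i => ‖x i‖ ^ 2) (fun _ _ => by positivity) (Finset.mem_univ i)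
  rw [← Real.norm_eq_abs]
  have h3 := norm_nonneg (x i)
  have h4 := norm_nonneg x
  nlinarith

theorem jb_gauge_slab {n : ℕ} {K : Set (EuclideanSpace ℝ (Fin n))}
    (hK1 : Metric.closedBall 0 1 ⊆ K) {u : EuclideanSpace ℝ (Fin n)} (hu : ∀ x ∈ K, |⟪x, u⟫| ≤ 1)
    {t : ℝ} {x : EuclideanSpace ℝ (Fin n)} (hx : gauge K x < t) : |⟪u, x⟫| < t := by
  have ha : Absorbent ℝ K := absorbent_nhds_zero (Filter.mem_of_superset (Metric.closedBall_mem_nhds _ one_pos) hK1)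
  obtain ⟨b, hb, hbt, hxb⟩ := exists_lt_of_gauge_lt ha hx
  obtain ⟨y, hy, rfl⟩ := hxb
  have := hu y hy
  rw [real_inner_comm] at this
  simp only [real_inner_smul_right, abs_mul, abs_of_pos hb]
  nlinarith

theorem jb_gauge_cube {n : ℕ} {t : ℝ} (ht : 0 < t) :
    {x | gauge (unitCube n) x < t} = {x : EuclideanSpace ℝ (Fin n) | ∀ i, |x i| < t} := by
  ext x
  constructor
  · intro hx i
    have := jb_gauge_slab (jb_unitCube_ball n) (u := EuclideanSpace.single i 1) (t := t) (x := x)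
      (fun y hy => by simpa [EuclideanSpace.inner_single_right] using hy i) hx
    simpa [EuclideanSpace.inner_single_left] using this
  · intro hx
    obtain ⟨b, hb0, hbt, hb⟩ : ∃ b, 0 < b ∧ b < t ∧ ∀ i, |x i| ≤ b := by
      have hfin : ∀ i, ∃ b, 0 < b ∧ b < t ∧ |x i| ≤ b := fun i =>
        ⟨max (|x i|) (t/2), by positivity, max_lt (hx i) (by linarith), le_max_left _ _⟩
      choose b h1 h2 h3 using hfin
      by_cases hn : (Finset.univ : Finset (Fin n)).Nonempty
      · obtain ⟨j, -, hj⟩ := Finset.exists_max_image Finset.univ b hn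
        exact ⟨b j, h1 j, h2 j, fun i => (h3 i).trans (hj i (Finset.mem_univ i))⟩
      · refine ⟨t/2, by linarith, by linarith, fun i => absurd ⟨i, Finset.mem_univ i⟩ hn⟩
    refine lt_of_le_of_lt (gauge_le_of_mem hb0.le ?_) hbt
    refine (Set.mem_smul_set_iff_inv_smul_mem₀ hb0.ne' _ _).2 fun i => ?_
    simp only [PiLp.smul_apply, smul_eq_mul, abs_mul, abs_inv, abs_of_pos hb0]
    rw [inv_mul_le_iff₀ hb0]; simpa using hb i


theorem jb_pos {n : ℕ} {V : Set (EuclideanSpace ℝ (Fin n))} (hV : IsOpen V) (hne : V.Nonempty) :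
    gaussianMeasure n V ≠ 0 := by
  intro h
  have hac : (volume : Measure (EuclideanSpace ℝ (Fin n))) ≪ gaussianMeasure n := by
    rw [gaussianMeasure]
    refine withDensity_absolutelyContinuous' (Measurable.aemeasurable (by fun_prop)) (Filter.Eventually.of_forall fun x => ?_)
    have : 0 < (2 * Real.pi) ^ (-(n : ℝ) / 2) * Real.exp (-‖x‖ ^ 2 / 2) := by positivity
    simpa using this
  exact (hV.measure_pos volume hne).ne' (hac h)

theorem jb_ortho {n : ℕ} {ι : Type} [Fintype ι] {c : ι → ℝ} {u : ι → EuclideanSpace ℝ (Fin n)}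
    (hu : ∀ i, ‖u i‖ = 1) (hid : ∀ x, ∑ i, (c i * ⟪u i, x⟫) • u i = x)
    (hd : ∀ i j, ⟪u i, u j⟫ = 0 ∨ ⟪u i, u j⟫ = 1 ∨ ⟪u i, u j⟫ = -1) :
    ∃ w : Fin n → EuclideanSpace ℝ (Fin n), Orthonormal ℝ w ∧
      {x | ∀ i, |⟪x, u i⟫| ≤ 1} = {x | ∀ i, |⟪x, w i⟫| ≤ 1} := by
  have hspan : Submodule.span ℝ (Set.range u) = ⊤ := by
    rw [eq_top_iff]
    intro x _
    rw [← hid x]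
    exact Submodule.sum_mem _ fun i _ => Submodule.smul_mem _ _ (Submodule.subset_span ⟨i, rfl⟩)
  obtain ⟨b, hbs, hbspan, hbli⟩ := exists_linearIndependent ℝ (Set.range u)
  rw [hspan] at hbspan
  let B : Module.Basis b ℝ (EuclideanSpace ℝ (Fin n)) := Module.Basis.mk hbli (by simp [hbspan])
  have hfin : Finite b := Module.Finite.finite_basis B
  have := Fintype.ofFinite b
  have hcard : Fintype.card b = n := by
    rw [← Module.finrank_eq_card_basis B]; simp
  let e : Fin n ≃ b := (Fintype.equivFinOfCardEq hcard).symm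
  let w : Fin n → EuclideanSpace ℝ (Fin n) := fun k => (e k : EuclideanSpace ℝ (Fin n))
  have hw : ∀ k, ∃ i, u i = w k := fun k => hbs (e k).2
  have hwn : ∀ k, ‖w k‖ = 1 := fun k => by obtain ⟨i, hi⟩ := hw k; rw [← hi]; exact hu i
  have hwli : LinearIndependent ℝ w := hbli.comp e e.injective
  have hpm : ∀ x y : EuclideanSpace ℝ (Fin n), ‖x‖ = 1 → ‖y‖ = 1 → (⟪x, y⟫ = 1 → x = y) ∧ (⟪x, y⟫ = -1 → x = -y) := by
    intro x y hx hy
    refine ⟨fun h => (inner_eq_one_iff_of_norm_eq_one (𝕜 := ℝ) hx hy).1 h, fun h => ?_⟩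
    refine (inner_eq_one_iff_of_norm_eq_one (𝕜 := ℝ) hx (by simpa using hy)).1 ?_
    rw [inner_neg_right, h]; norm_num
  have hon : Orthonormal ℝ w := by
    refine ⟨hwn, fun k l hkl => ?_⟩
    obtain ⟨i, hi⟩ := hw k
    obtain ⟨j, hj⟩ := hw l
    have h := hd i j
    rw [hi, hj] at h
    rcases h with h | h | h
    · exact h
    · exact absurd (hwli.injective ((hpm _ _ (hwn k) (hwn l)).1 h)) hkl
    · exfalso
      have h2 := (hpm _ _ (hwn k) (hwn l)).2 h
      have h3 := Fintype.linearIndependent_iff.1 hwli (Pi.single k 1 + Pi.single l 1)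
        (by simp [add_smul, Finset.sum_add_distrib, Pi.single_apply, ite_smul, h2]) k
      simp [hkl] at h3
  have hwspan : Submodule.span ℝ (Set.range w) = ⊤ := by
    have : Set.range w = b := by
      have : Set.range w = Set.range (Subtype.val : b → EuclideanSpace ℝ (Fin n)) :=
        e.surjective.range_comp (Subtype.val : b → EuclideanSpace ℝ (Fin n))
      rw [this]; simp
    rw [this, hbspan]
  have hui : ∀ i, ∃ k, u i = w k ∨ u i = - w k := by
    intro i
    by_contra hcon
    push Not at hcon
    have hz : ∀ k, ⟪w k, u i⟫ = 0 := by
      intro k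
      obtain ⟨j, hj⟩ := hw k
      have h := hd i j
      rw [hj] at h
      rw [real_inner_comm]
      rcases h with h | h | h
      · exact h
      · exact absurd ((hpm _ _ (hu i) (hwn k)).1 h) (hcon k).1
      · exact absurd ((hpm _ _ (hu i) (hwn k)).2 h) (hcon k).2
    have hmem : u i ∈ (Submodule.span ℝ (Set.range w))ᗮ := by
      rw [Submodule.mem_orthogonal]
      intro y hy
      induction hy using Submodule.span_induction with
      | mem y hy => obtain ⟨k, rfl⟩ := hy; exact hz k
      | zero => simp
      | add a b _ _ ha hb => rw [inner_add_left, ha, hb, add_zero]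
      | smul r a _ ha => rw [real_inner_smul_left, ha, mul_zero]
    rw [hwspan, Submodule.top_orthogonal_eq_bot, Submodule.mem_bot] at hmem
    have := hu i
    rw [hmem] at this
    simp at this
  refine ⟨w, hon, ?_⟩
  ext x
  constructor
  · intro hx k
    obtain ⟨i, hi⟩ := hw k
    rw [← hi]; exact hx i
  · intro hx i
    obtain ⟨k, hk | hk⟩ := hui i
    · rw [hk]; exact hx k
    · rw [hk, inner_neg_right, abs_neg]; exact hx k

theorem jb_converse {n : ℕ} {w : Fin n → EuclideanSpace ℝ (Fin n)} (hw : Orthonormal ℝ w) :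
    ellNorm {x | ∀ i, |⟪x, w i⟫| ≤ 1} = ellNorm (unitCube n) := by
  have hsp : ⊤ ≤ Submodule.span ℝ (Set.range w) := by
    rw [hw.linearIndependent.span_eq_top_of_card_eq_finrank' (by simp)]
  let b := OrthonormalBasis.mk hw hsp
  have hb : ∀ i, b i = w i := fun i => by simp [b]
  have hK : {x | ∀ i, |⟪x, w i⟫| ≤ 1} = b.repr ⁻¹' (unitCube n) := by
    ext x
    simp only [unitCube, Set.mem_ofPred_eq, Set.mem_preimage, b.repr_apply_apply, hb, real_inner_comm]
  have hg : ∀ x, gauge (b.repr ⁻¹' (unitCube n)) x = gauge (unitCube n) (b.repr x) := by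
    intro x
    rw [gauge_def', gauge_def']
    simp
  rw [hK, ellNorm, ellNorm, gaussianMeasure]
  simp only [hg]
  have hm : Measurable (fun x : EuclideanSpace ℝ (Fin n) => ENNReal.ofReal ((2 * Real.pi) ^ (-(n : ℝ) / 2) * Real.exp (-‖x‖ ^ 2 / 2))) := by fun_prop
  rw [integral_withDensity_eq_integral_toReal_smul hm (Filter.Eventually.of_forall fun x => ENNReal.ofReal_lt_top),
    integral_withDensity_eq_integral_toReal_smul hm (Filter.Eventually.of_forall fun x => ENNReal.ofReal_lt_top)]
  refine Eq.trans ?_ ((LinearIsometryEquiv.measurePreserving b.repr).integral_comp b.repr.toHomeomorph.measurableEmbedding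
    (fun x => (ENNReal.ofReal ((2 * Real.pi) ^ (-(n : ℝ) / 2) * Real.exp (-‖x‖ ^ 2 / 2))).toReal • gauge (unitCube n) x))
  simp only [LinearIsometryEquiv.norm_map]


theorem jb_antitone {n : ℕ} (K : Set (EuclideanSpace ℝ (Fin n))) :
    Measurable (fun t : ℝ => gaussianMeasure n {x | t ≤ gauge K x}) :=
  Antitone.measurable fun _ _ hst => measure_mono fun _ hx => le_trans hst hx

theorem jb_eqK {n : ℕ} {K : Set (EuclideanSpace ℝ (Fin n))} {ι : Type} [Fintype ι]
    {u : ι → EuclideanSpace ℝ (Fin n)} (hc : Convex ℝ K) (hcl : IsClosed K)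
    (hK1 : Metric.closedBall 0 1 ⊆ K) (huK : ∀ i, ∀ x ∈ K, |⟪x, u i⟫| ≤ 1) {t : ℝ} (ht : 0 < t)
    (h : gaussianMeasure n {x | ∀ i, |⟪u i, x⟫| < t} ≤ gaussianMeasure n {x | gauge K x < t}) :
    K = {x | ∀ i, |⟪x, u i⟫| ≤ 1} := by
  have := jb_prob n
  obtain ⟨hgc, -, -⟩ := jb_gauge hc hK1
  refine Set.Subset.antisymm (fun x hx i => huK i x hx) fun x hx => ?_
  by_contra hxK
  have hg : 1 < gauge K x := by
    by_contra hle
    have := (gauge_le_one_iff_mem_closure hc (Filter.mem_of_superset (Metric.closedBall_mem_nhds _ one_pos) hK1)).1 (not_lt.1 hle)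
    rw [hcl.closure_eq] at this
    exact hxK this
  set V : Set (EuclideanSpace ℝ (Fin n)) := {x | ∀ i, |⟪u i, x⟫| < t} ∩ {x | t < gauge K x} with hV
  have hUopen : IsOpen {x | ∀ i, |⟪u i, x⟫| < t} := by
    have : {x | ∀ i, |⟪u i, x⟫| < t} = ⋂ i, {x | |⟪u i, x⟫| < t} := by ext; simp
    rw [this]
    exact isOpen_iInter_of_finite fun i => isOpen_lt (by fun_prop) continuous_const
  have hVo : IsOpen V := hUopen.inter (isOpen_lt continuous_const hgc)
  have hVne : V.Nonempty := by
    obtain ⟨l, hl1, hl2⟩ := exists_between (inv_lt_one_of_one_lt₀ hg)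
    have hl0 : 0 < l := lt_trans (by positivity) hl1
    refine ⟨(l * t) • x, fun i => ?_, ?_⟩
    · have := hx i
      rw [real_inner_comm] at this
      rw [real_inner_smul_right, abs_mul, abs_of_pos (by positivity)]
      nlinarith [mul_pos hl0 ht]
    · show t < gauge K ((l * t) • x)
      rw [gauge_smul_of_nonneg (by positivity), smul_eq_mul]
      have : 1 < l * gauge K x := by rwa [inv_lt_iff_one_lt_mul₀ (by positivity)] at hl1
      nlinarith
  have hd : Disjoint {x | gauge K x < t} V := by
    rw [Set.disjoint_left]
    intro y hy hyV
    exact lt_asymm (show gauge K y < t from hy) hyV.2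
  have hsub : {x | gauge K x < t} ∪ V ⊆ {x | ∀ i, |⟪u i, x⟫| < t} := by
    rintro y (hy | hy)
    · exact fun i => jb_gauge_slab hK1 (huK i) hy
    · exact hy.1
  have h1 := measure_mono (μ := gaussianMeasure n) hsub
  rw [measure_union hd hVo.measurableSet] at h1
  have h2 := h1.trans h
  have h3 : gaussianMeasure n V ≤ 0 := by
    have : gaussianMeasure n {x | gauge K x < t} + gaussianMeasure n V ≤ gaussianMeasure n {x | gauge K x < t} + 0 := by simpa using h2
    exact (ENNReal.add_le_add_iff_left (measure_ne_top _ _)).1 this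
  exact jb_pos hVo hVne (le_antisymm h3 bot_le)


/-- If `K` is an origin-symmetric convex body whose John ellipsoid is the unit ball
(`B^n_2 ⊆ K` and every ellipsoid contained in `K` has volume at most that of `B^n_2`),
then `ℓ(K) ≥ ℓ(B^n_∞)`, with equality if and only if `K` is a cube circumscribed about
`B^n_2`. -/
theorem ell_ge_of_john_ball (n : ℕ) (K : Set (EuclideanSpace ℝ (Fin n)))
    (hKconv : Convex ℝ K) (hKcomp : IsCompact K) (hKint : (interior K).Nonempty)
    (hKsymm : ∀ x ∈ K, -x ∈ K)
    (hK1 : Metric.closedBall 0 1 ⊆ K)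
    (hJohn : ∀ T : EuclideanSpace ℝ (Fin n) ≃L[ℝ] EuclideanSpace ℝ (Fin n),
      T '' Metric.closedBall 0 1 ⊆ K →
        volume (T '' Metric.closedBall 0 1) ≤
          volume (Metric.closedBall (0 : EuclideanSpace ℝ (Fin n)) 1)) :
    ellNorm (unitCube n) ≤ ellNorm K ∧
      (ellNorm K = ellNorm (unitCube n) ↔
        ∃ w : Fin n → EuclideanSpace ℝ (Fin n), Orthonormal ℝ w ∧
          K = {x | ∀ i, |⟪x, w i⟫| ≤ 1}) := by
  have := jb_prob n
  obtain ⟨ι, _, c, u, hc, hu, huK, hid⟩ := jb_john hKconv hKcomp hKsymm hK1 hJohn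
  have hlt : ∀ t : ℝ, 0 < t → gaussianMeasure n {x | gauge K x < t} ≤ gaussianMeasure n {x | ∀ i, |⟪u i, x⟫| < t} :=
    fun t _ => measure_mono fun x hx i => jb_gauge_slab hK1 (huK i) hx
  have hle : ∀ t : ℝ, 0 < t → gaussianMeasure n {x | t ≤ gauge (unitCube n) x} ≤ gaussianMeasure n {x | t ≤ gauge K x} := by
    intro t ht
    rw [jb_compl hKconv hK1, jb_compl (jb_unitCube_convex n) (jb_unitCube_ball n), jb_gauge_cube ht, jb_cube n t ht]
    exact tsub_le_tsub_left ((hlt t ht).trans (jb_BL hc hu hid t ht).1) _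
  have hnn : 0 ≤ ellNorm K := integral_nonneg fun x => gauge_nonneg x
  have hL1 := jb_layer hKconv hK1
  have hL2 := jb_layer (jb_unitCube_convex n) (jb_unitCube_ball n)
  constructor
  · rw [← ENNReal.ofReal_le_ofReal_iff hnn, hL1, hL2]
    exact setLIntegral_mono' measurableSet_Ioi fun t ht => hle t ht
  constructor
  · intro heq
    have hae := ae_eq_of_ae_le_of_lintegral_le (μ := volume.restrict (Set.Ioi (0:ℝ)))
      ((ae_restrict_iff' measurableSet_Ioi).2 (Filter.Eventually.of_forall hle))
      (by rw [← hL2]; exact ENNReal.ofReal_ne_top) (jb_antitone K).aemeasurable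
      (by rw [← hL1, ← hL2, heq])
    have hne : (ae (volume.restrict (Set.Ioi (0:ℝ)))).NeBot := by
      rw [ae_neBot]
      intro h0
      have := Measure.restrict_eq_zero.1 h0
      simp at this
    obtain ⟨t, hteq, ht⟩ := (hae.and (ae_restrict_mem measurableSet_Ioi)).exists
    have ht0 : 0 < t := ht
    beta_reduce at hteq
    rw [jb_compl hKconv hK1, jb_compl (jb_unitCube_convex n) (jb_unitCube_ball n), jb_gauge_cube ht0, jb_cube n t ht0] at hteq
    have hBL := jb_BL hc hu hid t ht0
    have hge : ENNReal.ofReal (((∫ x in (-t)..t, Real.exp (-x ^ 2 / 2)) / √(2 * Real.pi)) ^ n) ≤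
        gaussianMeasure n {x | gauge K x < t} := by
      have h1 : ENNReal.ofReal (((∫ x in (-t)..t, Real.exp (-x ^ 2 / 2)) / √(2 * Real.pi)) ^ n) ≤ 1 := by
        rw [← jb_cube n t ht0]; exact prob_le_one
      have h2 : gaussianMeasure n {x | gauge K x < t} ≤ 1 := prob_le_one
      have h3 := (ENNReal.sub_right_inj ENNReal.one_ne_top h1 h2).1 hteq
      exact h3.le
    obtain ⟨w, hw, hPw⟩ := jb_ortho hu hid (hBL.2 (hge.trans (hlt t ht0)))
    refine ⟨w, hw, ?_⟩
    rw [← hPw]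
    exact jb_eqK hKconv hKcomp.isClosed hK1 huK ht0 (hBL.1.trans hge)
  · rintro ⟨w, hw, rfl⟩
    exact jb_converse hw
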